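/- Let I = Borel(M,N) be a two-Borel ideal and let μ be a monomial divisible by both M and N. Then either every sink of →Γ_μ(I) has type M, or every sink of →Γ_μ(I) has type N. -/

import Mathlib

/-!  Monomials in `K[x_1,…,x_n]` are identified with their exponent vectors in `Fin n → ℕ`
(`0`-based indexing: `x_1` corresponds to index `0`).  -/

variable {n : ℕ}

/-- Cumulative exponent vector (`0`-based): `cexp m i = m i + m (i+1) + ⋯ + m (n-1)`,
so `cexp m i` is the paper's `σ_{i+1}(m)`, and `cexp m n = 0` is the convention
`σ_{n+1}(m) = 0`. -/
def cexp (m : Fin n → ℕ) (i : ℕ) : ℕ :=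
  ∑ k : Fin n, if i ≤ (k : ℕ) then m k else 0

/-- `mshift m src tgt` is the exponent vector of `(x_tgt / x_src) · m` (only used when
`src ≠ tgt` and `x_src` divides `m`).  Thus `mshift m j i` is the Borel move `B_{j→i}(m)`
(for `i < j`) and `mshift m i j` is the reverse Borel move `RB_{i→j}(m)` (for `i < j`). -/
def mshift (m : Fin n → ℕ) (src tgt : Fin n) : Fin n → ℕ :=
  fun k => if k = tgt then m tgt + 1 else if k = src then m src - 1 else m k

/-- `BorelStep a b` : `b` is obtained from `a` by a single Borel move `B_{j→i}`, `i < j`. -/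
def BorelStep (a b : Fin n → ℕ) : Prop :=
  ∃ i j : Fin n, i < j ∧ 0 < a j ∧ b = mshift a j i

/-- `InBorel m m'` : `m ∈ Borel(m')`, i.e. `m` is obtained from `m'` by a finite (possibly
empty) sequence of Borel moves. -/
def InBorel (m m' : Fin n → ℕ) : Prop := Relation.ReflTransGen BorelStep m' m

/-- Divisibility of monomials: `m` divides `μ`. -/
def mDvd (m μ : Fin n → ℕ) : Prop := ∀ k, m k ≤ μ k

/-- `mLexLt m m'` : `m` is lexicographically smaller than `m'` (lex order with
`x_1 > x_2 > ⋯ > x_n`); i.e. `m` comes *later* than `m'` in the lex listing of monomials. -/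
def mLexLt (m m' : Fin n → ℕ) : Prop :=
  ∃ i : Fin n, (∀ k, k < i → m k = m' k) ∧ m i < m' i

/-- Total degree of a monomial. -/
def mDeg (m : Fin n → ℕ) : ℕ := ∑ k, m k

/-- A vertex of the fiber graph `Γ_μ(I)`, where `G` is the minimal monomial generating set of
`I`: a multiset of elements of `G` whose product (sum of exponent vectors) is `μ`. -/
def FiberVertex (G : Set (Fin n → ℕ)) (μ : Fin n → ℕ) (Z : Multiset (Fin n → ℕ)) : Prop :=
  (∀ w ∈ Z, w ∈ G) ∧ Z.sum = μ

/-- Adjacency in the fiber graph `Γ_μ(I)`: `Z` is obtained from `Z'` by applying a Borel move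
`B_{j→i}` to one element and the corresponding reverse Borel move `RB_{i→j}` to another,
leaving all other elements unchanged. -/
def FiberAdj (G : Set (Fin n → ℕ)) (μ : Fin n → ℕ) (Z Z' : Multiset (Fin n → ℕ)) : Prop :=
  FiberVertex G μ Z ∧ FiberVertex G μ Z' ∧
  ∃ (W : Multiset (Fin n → ℕ)) (u v u' v' : Fin n → ℕ) (i j : Fin n),
    i < j ∧ Z = u ::ₘ v ::ₘ W ∧ Z' = u' ::ₘ v' ::ₘ W ∧
    0 < u' j ∧ u = mshift u' j i ∧ 0 < v' i ∧ v = mshift v' i j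

/-- `G_M`: the minimal monomial generators of `Borel(M)`, i.e. (for the equigenerated Borel
ideal `I = Borel(M,N)`) the degree-`d` monomials in `Borel(M)`. -/
def gensM (M : Fin n → ℕ) : Set (Fin n → ℕ) := {w | InBorel w M}

/-- `G_N = gens(I) ∖ G_M` for `I = Borel(M,N)`. -/
def gensN (M N : Fin n → ℕ) : Set (Fin n → ℕ) := {w | InBorel w N ∧ ¬ InBorel w M}

/-- The minimal monomial generating set `G` of the two-Borel ideal `I = Borel(M,N)`. -/
def gens2 (M N : Fin n → ℕ) : Set (Fin n → ℕ) := {w | InBorel w M ∨ InBorel w N}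

/-- The fiber sink variable order: `varBefore M N w₁ w₂` says the variable `Y_{w₁}` comes
(strictly) before `Y_{w₂}`.  First come the `w ∈ G_N`, with `Y_N` first (lex-smaller `w`
first), then the `w ∈ G_M`, with `Y_M` last (lex-larger `w` first). -/
def varBefore (M N : Fin n → ℕ) (w₁ w₂ : Fin n → ℕ) : Prop :=
  (w₁ ∈ gensN M N ∧ w₂ ∈ gensM M) ∨
  (w₁ ∈ gensN M N ∧ w₂ ∈ gensN M N ∧ mLexLt w₁ w₂) ∨
  (w₁ ∈ gensM M ∧ w₂ ∈ gensM M ∧ mLexLt w₂ w₁)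

/-- The fiber sink order (reverse lexicographic order induced by the fiber sink variable
order): `laterThan M N Z Z'` says the monomial `∏_{w ∈ Z} Y_w` comes strictly *later* than
`∏_{w ∈ Z'} Y_w`; i.e. at the last variable (in the fiber sink variable order) where the two
multisets have different multiplicities, `Z` has the larger multiplicity. -/
def laterThan (M N : Fin n → ℕ) (Z Z' : Multiset (Fin n → ℕ)) : Prop :=
  ∃ w, Z'.count w < Z.count w ∧ ∀ u, varBefore M N w u → Z.count u = Z'.count u

/-- A sink of the directed fiber graph `→Γ_μ(I)` for `I = Borel(M,N)` (edges are directed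
toward the endpoint that is later in the fiber sink order): a vertex that is later than all
of its neighbors. -/
def IsSink (M N μ : Fin n → ℕ) (Z : Multiset (Fin n → ℕ)) : Prop :=
  FiberVertex (gens2 M N) μ Z ∧
  ∀ Z', FiberAdj (gens2 M N) μ Z Z' → Z' ≠ Z → laterThan M N Z Z'

theorem cexp_add (a b : Fin n → ℕ) (k : ℕ) : cexp (a + b) k = cexp a k + cexp b k := by
  unfold cexp
  rw [← Finset.sum_add_distrib]
  refine Finset.sum_congr rfl fun x _ => ?_
  by_cases h : k ≤ (x : ℕ) <;> simp [h]

theorem cexp_single (s : Fin n) (k : ℕ) :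
    cexp (Pi.single s 1 : Fin n → ℕ) k = if k ≤ (s : ℕ) then 1 else 0 := by
  unfold cexp
  rw [Finset.sum_eq_single s]
  · simp
  · intro b _ hb
    simp [hb]
  · simp

theorem mshift_add (m : Fin n → ℕ) (s t : Fin n) (hst : s ≠ t) (hs : 0 < m s) :
    mshift m s t + Pi.single s 1 = m + Pi.single t 1 := by
  funext k
  simp only [mshift, Pi.add_apply, Pi.single_apply]
  by_cases h1 : k = t
  · subst h1
    simp [Ne.symm hst]
  · by_cases h2 : k = s
    · subst h2
      simp [h1]
      omega
    · simp [h1, h2]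

theorem cexp_mshift (m : Fin n → ℕ) (s t : Fin n) (hst : s ≠ t) (hs : 0 < m s) (k : ℕ) :
    cexp (mshift m s t) k + (if k ≤ (s : ℕ) then 1 else 0)
      = cexp m k + (if k ≤ (t : ℕ) then 1 else 0) := by
  rw [← cexp_single, ← cexp_single, ← cexp_add, ← cexp_add, mshift_add m s t hst hs]

theorem cexp_zero_eq (m : Fin n → ℕ) : cexp m 0 = mDeg m := by
  simp [cexp, mDeg]

theorem cexp_top (m : Fin n → ℕ) (k : ℕ) (hk : n ≤ k) : cexp m k = 0 := by
  unfold cexp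
  refine Finset.sum_eq_zero fun x _ => ?_
  have := x.2
  rw [if_neg (by omega)]

theorem cexp_succ (m : Fin n → ℕ) (k : Fin n) : cexp m k = m k + cexp m (k + 1) := by
  have h : ∀ x : Fin n, (if (k : ℕ) ≤ (x : ℕ) then m x else 0)
      = (if x = k then m x else 0) + (if (k : ℕ) + 1 ≤ (x : ℕ) then m x else 0) := by
    intro x
    by_cases h1 : x = k
    · subst h1; simp
    · have h2 : (x : ℕ) ≠ k := fun h => h1 (Fin.ext h)
      by_cases h3 : (k : ℕ) ≤ x
      · have : (k : ℕ) + 1 ≤ x := by omega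
        simp [h1, h3, this]
      · have : ¬ (k : ℕ) + 1 ≤ x := by omega
        simp [h1, h3, this]
  unfold cexp
  rw [Finset.sum_congr rfl fun x _ => h x, Finset.sum_add_distrib]
  simp

theorem cexp_anti (m : Fin n → ℕ) {a b : ℕ} (h : a ≤ b) : cexp m b ≤ cexp m a := by
  unfold cexp
  refine Finset.sum_le_sum fun x _ => ?_
  by_cases h1 : b ≤ (x : ℕ)
  · have : a ≤ (x : ℕ) := by omega
    simp [h1, this]
  · simp [h1]

theorem inBorel_imp {w M : Fin n → ℕ} (h : InBorel w M) :
    mDeg w = mDeg M ∧ ∀ k, cexp w k ≤ cexp M k := by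
  unfold InBorel at h
  induction h with
  | refl => exact ⟨rfl, fun _ => le_rfl⟩
  | tail _ hbc ih =>
    obtain ⟨i, j, hij, hj, rfl⟩ := hbc
    have hij' : (i : ℕ) < j := hij
    have key := cexp_mshift _ j i (ne_of_gt hij) hj
    refine ⟨?_, fun k => ?_⟩
    · have := key 0
      rw [← cexp_zero_eq]
      rw [← ih.1, ← cexp_zero_eq]
      simpa using this
    · have h1 := key k
      have h2 := ih.2 k
      split_ifs at h1 <;> omega

theorem inBorel_of {w : Fin n → ℕ} : ∀ (s : ℕ) (M : Fin n → ℕ),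
    ∑ k ∈ Finset.range n, cexp M k = s → mDeg w = mDeg M → (∀ k, cexp w k ≤ cexp M k) →
    InBorel w M := by
  intro s
  induction s using Nat.strong_induction_on with
  | _ s ih =>
    intro M hs hd hle
    by_cases hex : ∃ l, l ≤ n ∧ cexp w l < cexp M l
    · classical
      let P : ℕ → Prop := fun l => cexp w l < cexp M l
      obtain ⟨l0, hl0, hl0'⟩ := hex
      let l := Nat.findGreatest P n
      have hl : P l := Nat.findGreatest_spec (P := P) hl0 hl0'
      have hln : l < n := by
        by_contra hc
        have : cexp w l < cexp M l := hl
        rw [cexp_top M l (by omega)] at this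
        omega
      have hlpos : 0 < l := by
        by_contra hc
        have h0 : l = 0 := by omega
        have : cexp w l < cexp M l := hl
        rw [h0, cexp_zero_eq, cexp_zero_eq] at this
        omega
      have hnext : cexp M (l + 1) ≤ cexp w (l + 1) := by
        have : ¬ P (l + 1) :=
          Nat.findGreatest_is_greatest (P := P) (n := n) (Nat.lt_succ_self l) (by omega)
        exact not_lt.mp this
      let j : Fin n := ⟨l, hln⟩
      let i : Fin n := ⟨l - 1, by omega⟩
      have hij : i < j := by
        show l - 1 < l
        omega
      have hMj : 0 < M j := by
        have h1 : cexp M l = M j + cexp M (l + 1) := cexp_succ M j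
        have h2 : cexp w l = w j + cexp w (l + 1) := cexp_succ w j
        have h3 : cexp w l < cexp M l := hl
        omega
      have key := cexp_mshift M j i (ne_of_gt hij) hMj
      have key' : ∀ k, cexp (mshift M j i) k + (if k = l then 1 else 0) = cexp M k := by
        intro k
        have h1 := key k
        have hj : (j : ℕ) = l := rfl
        have hi : (i : ℕ) = l - 1 := rfl
        rw [hj, hi] at h1
        split_ifs at h1 ⊢ <;> omega
      have hstep : BorelStep M (mshift M j i) := ⟨i, j, hij, hMj, rfl⟩
      have hlt : ∑ k ∈ Finset.range n, cexp (mshift M j i) k < s := by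
        rw [← hs]
        refine Finset.sum_lt_sum (fun k _ => ?_) ⟨l, Finset.mem_range.mpr hln, ?_⟩
        · have := key' k
          omega
        · have := key' l
          simp at this
          omega
      have hrec := ih _ hlt (mshift M j i) rfl
        (by
          rw [hd, ← cexp_zero_eq, ← cexp_zero_eq, ← key' 0, if_neg (by omega)]
          rfl)
        (by
          intro k
          have h1 := key' k
          have h2 := hle k
          by_cases hk : k = l
          · subst hk
            have h3 : cexp w l < cexp M l := hl
            rw [if_pos rfl] at h1
            omega
          · rw [if_neg hk] at h1
            omega)
      exact Relation.ReflTransGen.head hstep hrec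
    · push Not at hex
      have hall : ∀ l, l ≤ n → cexp w l = cexp M l := fun l hl => le_antisymm (hle l) (hex l hl)
      have : w = M := by
        funext k
        have h1 := cexp_succ w k
        have h2 := cexp_succ M k
        have h3 := hall k (by omega)
        have h4 := hall (k + 1) (by omega)
        omega
      rw [this]
      exact Relation.ReflTransGen.refl

theorem inBorel_iff {w M : Fin n → ℕ} :
    InBorel w M ↔ mDeg w = mDeg M ∧ ∀ k, cexp w k ≤ cexp M k :=
  ⟨inBorel_imp, fun h => inBorel_of _ M rfl h.1 h.2⟩

theorem cexp_sum (Z : Multiset (Fin n → ℕ)) (k : ℕ) :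
    cexp Z.sum k = (Z.map fun w => cexp w k).sum := by
  induction Z using Multiset.induction with
  | empty => simp [cexp]
  | cons a s ih => simp [cexp_add, ih]

theorem mshift_back (m : Fin n → ℕ) (s t : Fin n) (hst : s ≠ t) (hs : 0 < m s) :
    m = mshift (mshift m s t) t s := by
  funext k
  simp only [mshift]
  by_cases h1 : k = s
  · subst h1
    simp [hst]
    omega
  · by_cases h2 : k = t
    · subst h2
      simp [h1]
    · simp [h1, h2]

/-- Key fact about a sink all of whose elements lie outside `Borel(M)`: a pair `u`, `v` with `v`
not lexicographically larger than `u` admits no spreading move. -/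
theorem sink_no_move (M N μ : Fin n → ℕ) (W : Multiset (Fin n → ℕ)) (u v : Fin n → ℕ)
    (hsink : IsSink M N μ (u ::ₘ v ::ₘ W))
    (hN : ∀ w ∈ u ::ₘ v ::ₘ W, w ∉ gensM M)
    (hvu : toLex v ≤ toLex u) (i l : Fin n) (hil : i < l) (hvi : 0 < v i) (hul : 0 < u l)
    (hB : InBorel (mshift v i l) N) : False := by
  classical
  have hmemN : ∀ w ∈ u ::ₘ v ::ₘ W, w ∈ gensN M N := by
    intro w hw
    have h1 := hN w hw
    rcases hsink.1.1 w hw with h | h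
    · exact absurd h h1
    · exact ⟨h, h1⟩
  have huN : InBorel u N := (hmemN u (by simp)).1
  have hu'N : InBorel (mshift u l i) N :=
    Relation.ReflTransGen.tail huN ⟨i, l, hil, hul, rfl⟩
  have hlex : toLex u < toLex (mshift u l i) := by
    refine ⟨i, fun k hk => ?_, ?_⟩
    · have h1 : k ≠ i := ne_of_lt hk
      have h2 : k ≠ l := ne_of_lt (hk.trans hil)
      simp [mshift, h1, h2]
    · simp [mshift]
  set u' := mshift u l i with hu'
  set v' := mshift v i l with hv'
  have hne1 : u' ≠ u := fun h => by rw [h] at hlex; exact lt_irrefl _ hlex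
  have hne2 : u' ≠ v := fun h => by rw [h] at hlex; exact absurd hvu (not_le.mpr hlex)
  have hsum : u' + v' = u + v := by
    have h1 := mshift_add u l i (ne_of_gt hil) hul
    have h2 := mshift_add v i l (ne_of_lt hil) hvi
    funext k
    have h1k := congrFun h1 k
    have h2k := congrFun h2 k
    simp only [Pi.add_apply] at h1k h2k ⊢
    rw [← hu'] at h1k
    rw [← hv'] at h2k
    omega
  have hcount : (u ::ₘ v ::ₘ W).count u' < (v' ::ₘ u' ::ₘ W).count u' := by
    rw [Multiset.count_cons_of_ne hne1, Multiset.count_cons_of_ne hne2]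
    have h1 : (u' ::ₘ W).count u' = W.count u' + 1 := Multiset.count_cons_self _ _
    have h2 := Multiset.count_le_count_cons u' v' (u' ::ₘ W)
    omega
  have hvert : FiberVertex (gens2 M N) μ (v' ::ₘ u' ::ₘ W) := by
    refine ⟨?_, ?_⟩
    · intro w hw
      rw [Multiset.mem_cons, Multiset.mem_cons] at hw
      rcases hw with rfl | rfl | hw
      · exact Or.inr hB
      · exact Or.inr hu'N
      · exact hsink.1.1 w (by simp [hw])
    · have h := hsink.1.2
      rw [Multiset.sum_cons, Multiset.sum_cons, ← add_assoc] at h ⊢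
      rw [add_comm v' u', hsum, h]
  have hadj : FiberAdj (gens2 M N) μ (u ::ₘ v ::ₘ W) (v' ::ₘ u' ::ₘ W) := by
    refine ⟨hsink.1, hvert, W, v, u, v', u', i, l, hil, Multiset.cons_swap _ _ _, rfl, ?_,
      mshift_back v i l (ne_of_lt hil) hvi, ?_, mshift_back u l i (ne_of_gt hil) hul⟩
    · simp [hv', mshift]
    · simp [hu', mshift]
  obtain ⟨w, hw1, hw2⟩ := hsink.2 _ hadj (fun h => by rw [h] at hcount; exact lt_irrefl _ hcount)
  have hw : w = u ∨ w = v := by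
    by_contra hc
    push Not at hc
    rw [Multiset.count_cons_of_ne hc.1, Multiset.count_cons_of_ne hc.2] at hw1
    have h1 := Multiset.count_le_count_cons w u' W
    have h2 := Multiset.count_le_count_cons w v' (u' ::ₘ W)
    omega
  have hwN : w ∈ gensN M N := by
    rcases hw with rfl | rfl <;> exact hmemN _ (by simp)
  have hwlt : toLex w < toLex u' := by
    rcases hw with rfl | rfl
    · exact hlex
    · exact lt_of_le_of_lt hvu hlex
  have hbefore : varBefore M N w u' := by
    by_cases hm : InBorel u' M
    · exact Or.inl ⟨hwN, hm⟩
    · refine Or.inr (Or.inl ⟨hwN, ⟨hu'N, hm⟩, ?_⟩)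
      obtain ⟨a, ha, hb⟩ := hwlt
      exact ⟨a, ha, hb⟩
  have := hw2 u' hbefore
  omega

theorem no_mixed (M N μ : Fin n → ℕ) (hdeg : mDeg M = mDeg N) (hdpos : 0 < mDeg N)
    (Z Z' : Multiset (Fin n → ℕ)) (hZ : FiberVertex (gens2 M N) μ Z)
    (w : Fin n → ℕ) (hwZ : w ∈ Z) (hwM : w ∈ gensM M)
    (hsink : IsSink M N μ Z') (hN : ∀ x ∈ Z', x ∉ gensM M) : False := by
  classical
  have hdegG : ∀ x, x ∈ gens2 M N → cexp x 0 = mDeg N := by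
    intro x hx
    rw [cexp_zero_eq]
    rcases hx with h | h
    · rw [(inBorel_imp h).1, hdeg]
    · exact (inBorel_imp h).1
  have hcardG : ∀ Y, FiberVertex (gens2 M N) μ Y → Y.card * mDeg N = cexp μ 0 := by
    intro Y hY
    rw [← hY.2, cexp_sum, Multiset.map_congr rfl fun x hx => hdegG x (hY.1 x hx)]
    simp
  have hcard : Z.card = Z'.card :=
    Nat.eq_of_mul_eq_mul_right hdpos ((hcardG Z hZ).trans (hcardG Z' hsink.1).symm)
  have hZ'pos : 0 < Z'.card := by
    rw [← hcard]
    exact Multiset.card_pos_iff_exists_mem.mpr ⟨w, hwZ⟩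
  obtain ⟨x0, hx0⟩ := Multiset.card_pos_iff_exists_mem.mp hZ'pos
  obtain ⟨u, hu, humax⟩ := Finset.exists_max_image Z'.toFinset (fun x => toLex x)
    ⟨x0, Multiset.mem_toFinset.mpr hx0⟩
  rw [Multiset.mem_toFinset] at hu
  obtain ⟨T, rfl⟩ := Multiset.exists_cons_of_mem hu
  obtain ⟨S, rfl⟩ := Multiset.exists_cons_of_mem hwZ
  have huN : InBorel u N := by
    rcases hsink.1.1 u hu with h | h
    · exact absurd h (hN u hu)
    · exact h
  -- maximal violation
  have hviol : ∃ k, k ≤ n ∧ cexp M k < cexp u k := by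
    by_contra hc
    push Not at hc
    refine hN u hu (inBorel_iff.mpr ⟨(inBorel_imp huN).1.trans hdeg.symm, fun k => ?_⟩)
    by_cases hk : k ≤ n
    · exact hc k hk
    · rw [cexp_top u k (by omega)]
      exact Nat.zero_le _
  let P : ℕ → Prop := fun k => cexp M k < cexp u k
  obtain ⟨k0, hk0, hk0'⟩ := hviol
  obtain ⟨l, hldef⟩ : ∃ l, l = Nat.findGreatest P n := ⟨_, rfl⟩
  have hl : cexp M l < cexp u l := by
    rw [hldef]
    exact Nat.findGreatest_spec (P := P) hk0 hk0'
  have hln : l < n := by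
    by_contra hc
    rw [cexp_top u l (by omega)] at hl
    omega
  have hnext : cexp u (l + 1) ≤ cexp M (l + 1) := by
    have : ¬ P (l + 1) :=
      Nat.findGreatest_is_greatest (P := P) (n := n) (by omega) (by omega)
    exact not_lt.mp this
  let j : Fin n := ⟨l, hln⟩
  have huj : 0 < u j := by
    have h1 : cexp u l = u j + cexp u (l + 1) := cexp_succ u j
    have h2 := cexp_anti M (Nat.le_succ l)
    have h3 : cexp M (l + 1) ≤ cexp M l := h2
    omega
  have hMN : cexp M l < cexp N l := lt_of_lt_of_le hl ((inBorel_imp huN).2 l)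
  have hT : ∀ v ∈ T, cexp v l = cexp N l := by
    intro v hv
    have hvmem : v ∈ u ::ₘ T := Multiset.mem_cons_of_mem hv
    have hvN : InBorel v N := by
      rcases hsink.1.1 v hvmem with h | h
      · exact absurd h (hN v hvmem)
      · exact h
    obtain ⟨hvd, hvle⟩ := inBorel_imp hvN
    by_contra hne
    have hlt : cexp v l < cexp N l := lt_of_le_of_ne (hvle l) hne
    -- the largest index `i < l` whose tail is full
    let Q : ℕ → Prop := fun k => cexp v k ≠ cexp v l
    have hQ0 : Q 0 := by
      have h1 := cexp_anti N (Nat.zero_le l)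
      have h2 : cexp v 0 = cexp N 0 := by rw [cexp_zero_eq, cexp_zero_eq, hvd]
      show cexp v 0 ≠ cexp v l
      omega
    obtain ⟨i, hidef⟩ : ∃ i, i = Nat.findGreatest Q l := ⟨_, rfl⟩
    have hQi : cexp v i ≠ cexp v l := by
      rw [hidef]
      exact Nat.findGreatest_spec (P := Q) (Nat.zero_le l) hQ0
    have hile : i ≤ l := by
      rw [hidef]
      exact Nat.findGreatest_le l
    have hil : i < l := lt_of_le_of_ne hile (fun h => hQi (by rw [h]))
    have hbetween : ∀ k, i < k → k ≤ l → cexp v k = cexp v l := by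
      intro k hk1 hk2
      have : ¬ Q k := Nat.findGreatest_is_greatest (P := Q) (n := l) (by omega) hk2
      exact not_not.mp this
    let i' : Fin n := ⟨i, by omega⟩
    have hvi : 0 < v i' := by
      have h1 : cexp v i = v i' + cexp v (i + 1) := cexp_succ v i'
      have h2 := hbetween (i + 1) (by omega) (by omega)
      omega
    have hij : i' < j := hil
    have key := cexp_mshift v i' j (ne_of_lt hij) hvi
    have hB : InBorel (mshift v i' j) N := by
      refine inBorel_iff.mpr ⟨?_, fun k => ?_⟩
      · rw [← hvd, ← cexp_zero_eq, ← cexp_zero_eq]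
        simpa using key 0
      · have h1 := key k
        have hi1 : (i' : ℕ) = i := rfl
        have hj1 : (j : ℕ) = l := rfl
        rw [hi1, hj1] at h1
        have h2 := hvle k
        by_cases hk1 : k ≤ i
        · rw [if_pos hk1, if_pos (by omega)] at h1
          omega
        · by_cases hk2 : k ≤ l
          · rw [if_neg hk1, if_pos hk2] at h1
            have h3 := hbetween k (by omega) hk2
            have h4 := cexp_anti N hk2
            omega
          · rw [if_neg hk1, if_neg hk2] at h1
            omega
    obtain ⟨W, rfl⟩ := Multiset.exists_cons_of_mem hv
    exact sink_no_move M N μ W u v hsink hN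
      (humax v (Multiset.mem_toFinset.mpr hvmem)) i' j hij hvi huj hB
  have hsumZ' : cexp u l + T.card * cexp N l = cexp μ l := by
    rw [← hsink.1.2, cexp_sum, Multiset.map_cons, Multiset.sum_cons,
      Multiset.map_congr rfl hT]
    simp
  have hsumZ : cexp w l + (S.map fun x => cexp x l).sum = cexp μ l := by
    rw [← hZ.2, cexp_sum, Multiset.map_cons, Multiset.sum_cons]
  have hwl : cexp w l ≤ cexp M l := (inBorel_imp hwM).2 l
  have hS : (S.map fun x => cexp x l).sum ≤ S.card * cexp N l := by
    have := Multiset.sum_le_card_nsmul (S.map fun x => cexp x l) (cexp N l) (by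
      intro y hy
      obtain ⟨x, hx, rfl⟩ := Multiset.mem_map.mp hy
      rcases hZ.1 x (Multiset.mem_cons_of_mem hx) with h | h
      · exact ((inBorel_imp h).2 l).trans hMN.le
      · exact (inBorel_imp h).2 l)
    simpa using this
  have hc : S.card = T.card := by simpa using hcard
  rw [hc] at hS
  omega

/-- Let `I = Borel(M,N)` be a two-Borel ideal and let `μ` be divisible by
both `M` and `N`.  Then either every sink of `→Γ_μ(I)` has type `M`, or every sink of
`→Γ_μ(I)` has type `N`. -/
theorem statement15 (M N μ : Fin n → ℕ) (d : ℕ) (hMd : mDeg M = d) (hNd : mDeg N = d)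
    (hlex : mLexLt N M) (hMμ : mDvd M μ) (hNμ : mDvd N μ) :
    (∀ Z, IsSink M N μ Z → ∃ w ∈ Z, w ∈ gensM M) ∨
    (∀ Z, IsSink M N μ Z → ∀ w ∈ Z, w ∈ gensN M N) := by
  by_cases h : ∀ Z, IsSink M N μ Z → ∃ w ∈ Z, w ∈ gensM M
  · exact Or.inl h
  · right
    push Not at h
    obtain ⟨Z', hZ', hN⟩ := h
    have hdpos : 0 < mDeg N := by
      obtain ⟨i, _, hi⟩ := hlex
      rw [hNd, ← hMd]
      have : M i ≤ mDeg M := Finset.single_le_sum (fun _ _ => Nat.zero_le _) (Finset.mem_univ i)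
      omega
    intro Z hZ w hw
    by_cases hm : InBorel w M
    · exact (no_mixed M N μ (hMd.trans hNd.symm) hdpos Z Z' hZ.1 w hw hm hZ' hN).elim
    · rcases hZ.1.1 w hw with h1 | h1
      · exact absurd h1 hm
      · exact ⟨h1, hm⟩
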